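/- arXiv:1410.6071 — 2 statements merged into one kernel-verified Lean document; each statement's English description precedes it below -/
import Mathlib

section
/- Finiteness of the kernel set (Proposition 1): Let A and C be real p×p matrices, regarded as complex matrices. Define the polynomial q(z) = det( z²·(C ⊗ Iₚ) + z·(A ⊗ Iₚ + Iₚ ⊗ A) + Iₚ ⊗ C ), which for z ≠ 0 equals z^{p²}·det((A + z·C) ⊗ Iₚ + Iₚ ⊗ (A + z⁻¹·C)). Assume q is not the zero polynomial. Then the kernel set { τ ∈ ℝ : τ > 0 and there exists ω ∈ ℝ, ω ≠ 0, with 0 < ωτ < 2π and det(iω·Iₚ − A − e^{−iωτ}·C) = 0 } is a finite set. -/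
open Matrix Kronecker Complex Polynomial

/-- The Kronecker sum `M ⊗ I + I ⊗ N` maps `v ⊗ w` to `(μ + ν) v ⊗ w` when `v` and `w` are
eigenvectors of `M` and `N` with eigenvalues `μ` and `ν`. -/
theorem kroneckerSum_mulVec {m n R : Type*} [Fintype m] [Fintype n] [DecidableEq m]
    [DecidableEq n] [CommRing R] {M : Matrix m m R} {N : Matrix n n R} {v : m → R} {w : n → R}
    {μ ν : R} (hv : M *ᵥ v = μ • v) (hw : N *ᵥ w = ν • w) :
    (M ⊗ₖ (1 : Matrix n n R) + (1 : Matrix m m R) ⊗ₖ N) *ᵥ (fun x => v x.1 * w x.2) =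
      (μ + ν) • fun x => v x.1 * w x.2 := by
  ext ⟨i, j⟩
  have hvi : ∑ k, M i k * v k = μ * v i := by simpa [mulVec, dotProduct] using congrFun hv i
  have hwj : ∑ l, N j l * w l = ν * w j := by simpa [mulVec, dotProduct] using congrFun hw j
  have h₁ : ((M ⊗ₖ (1 : Matrix n n R)) *ᵥ fun x => v x.1 * w x.2) (i, j) = μ * v i * w j := by
    rw [← hvi, Finset.sum_mul]
    simp [mulVec, dotProduct, Fintype.sum_prod_type, one_apply, mul_assoc]
  have h₂ : (((1 : Matrix m m R) ⊗ₖ N) *ᵥ fun x => v x.1 * w x.2) (i, j) = ν * w j * v i := by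
    rw [← hwj, Finset.sum_mul]
    simp only [mulVec, dotProduct, Fintype.sum_prod_type, kroneckerMap_apply, one_apply]
    rw [Finset.sum_eq_single i (by intro b _ hb; simp [hb.symm]) (by simp)]
    exact Finset.sum_congr rfl fun l _ => by simp; ring
  rw [add_mulVec, Pi.add_apply, h₁, h₂, Pi.smul_apply, smul_eq_mul]
  ring

/-- If a real pencil `A + z C` with `z` on the unit circle has a purely imaginary eigenvalue, then
the auxiliary characteristic determinant vanishes at `z`. -/
theorem det_auxiliary_eq_zero {n : Type*} [Fintype n] [DecidableEq n] (A C : Matrix n n ℝ)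
    {z μ : ℂ} (hz : z * (starRingEnd ℂ) z = 1) (hμ : μ + (starRingEnd ℂ) μ = 0)
    (hdet : (μ • (1 : Matrix n n ℂ) - A.map ofReal - z • C.map ofReal).det = 0) :
    (z ^ 2 • (C.map ofReal ⊗ₖ (1 : Matrix n n ℂ))
      + z • (A.map ofReal ⊗ₖ (1 : Matrix n n ℂ) + (1 : Matrix n n ℂ) ⊗ₖ A.map ofReal)
      + (1 : Matrix n n ℂ) ⊗ₖ C.map ofReal).det = 0 := by
  obtain ⟨v, hv0, hv⟩ := exists_mulVec_eq_zero_iff.2 hdet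
  have hM : (A.map ofReal + z • C.map ofReal) *ᵥ v = μ • v := by
    rw [sub_sub, sub_mulVec, smul_mulVec, one_mulVec, sub_eq_zero] at hv
    exact hv.symm
  have hN : (A.map ofReal + (starRingEnd ℂ) z • C.map ofReal) *ᵥ (fun i => (starRingEnd ℂ) (v i)) =
      (starRingEnd ℂ) μ • fun i => (starRingEnd ℂ) (v i) := by
    ext i
    simpa [mulVec, dotProduct] using congrArg (starRingEnd ℂ) (congrFun hM i)
  have hK := kroneckerSum_mulVec hM hN
  rw [hμ, zero_smul] at hK
  obtain ⟨i, hi⟩ := Function.ne_iff.1 hv0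
  refine exists_mulVec_eq_zero_iff.1 ⟨fun x : n × n => v x.1 * (starRingEnd ℂ) (v x.2),
    Function.ne_iff.2 ⟨(i, i), by simpa using hi⟩, ?_⟩
  have hfac : z ^ 2 • (C.map ofReal ⊗ₖ (1 : Matrix n n ℂ))
      + z • (A.map ofReal ⊗ₖ (1 : Matrix n n ℂ) + (1 : Matrix n n ℂ) ⊗ₖ A.map ofReal)
      + (1 : Matrix n n ℂ) ⊗ₖ C.map ofReal =
      z • ((A.map ofReal + z • C.map ofReal) ⊗ₖ (1 : Matrix n n ℂ)
        + (1 : Matrix n n ℂ) ⊗ₖ (A.map ofReal + (starRingEnd ℂ) z • C.map ofReal)) := by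
    rw [add_kronecker, kronecker_add, smul_kronecker, kronecker_smul]
    simp only [smul_add, smul_smul, hz, one_smul, sq]
    abel
  rw [hfac, smul_mulVec, hK, smul_zero]

/-- On `0 < ωτ < 2π` with `ω` fixed, the delay `τ` is determined by `exp (-iωτ)`. -/
theorem delay_eq_of_exp_eq {ω τ σ : ℝ} (hω : ω ≠ 0) (hτ : 0 < ω * τ) (hτ' : ω * τ < 2 * Real.pi)
    (hσ : 0 < ω * σ) (hσ' : ω * σ < 2 * Real.pi)
    (h : exp (-(I * (ω : ℂ) * (τ : ℂ))) = exp (-(I * (ω : ℂ) * (σ : ℂ)))) : τ = σ := by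
  obtain ⟨k, hk⟩ := exp_eq_exp_iff_exists_int.1 h
  have hr : ω * σ = ω * τ + k * (2 * Real.pi) := by
    have := congrArg Complex.im hk
    simp at this
    linarith
  have hπ := Real.pi_pos
  have h₁ : (k : ℝ) < 1 := by nlinarith
  have h₂ : (-1 : ℝ) < k := by nlinarith
  have hk0 : k = 0 := by
    have h₁' : k < 1 := by exact_mod_cast h₁
    have h₂' : -1 < k := by exact_mod_cast h₂
    omega
  rw [hk0] at hr
  exact (mul_left_cancel₀ hω (by simpa using hr)).symm

/-- Finiteness of the kernel set: let `q(z)` be the polynomial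
`det(z²·(C ⊗ I) + z·(A ⊗ I + I ⊗ A) + I ⊗ C)` (which for `z ≠ 0` equals
`z^{p²}` times the auxiliary characteristic determinant
`det((A + zC) ⊗ I + I ⊗ (A + z⁻¹C))`). If `q` is not the zero polynomial,
then the kernel set of delays is finite. -/
theorem kernel_set_finite
    {p : ℕ} (A C : Matrix (Fin p) (Fin p) ℝ)
    (q : Polynomial ℂ)
    (hq : q = Matrix.det
      ((Polynomial.X ^ 2 : Polynomial ℂ) •
          ((C.map (Complex.ofReal) ⊗ₖ (1 : Matrix (Fin p) (Fin p) ℂ)).map Polynomial.C)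
        + (Polynomial.X : Polynomial ℂ) •
          ((A.map (Complex.ofReal) ⊗ₖ (1 : Matrix (Fin p) (Fin p) ℂ)
            + (1 : Matrix (Fin p) (Fin p) ℂ) ⊗ₖ A.map (Complex.ofReal)).map Polynomial.C)
        + (((1 : Matrix (Fin p) (Fin p) ℂ) ⊗ₖ C.map (Complex.ofReal)).map Polynomial.C)))
    (hq0 : q ≠ 0) :
    Set.Finite {τ : ℝ | 0 < τ ∧ ∃ ω : ℝ, ω ≠ 0 ∧ 0 < ω * τ ∧ ω * τ < 2 * Real.pi ∧
      ((Complex.I * (ω : ℂ)) • (1 : Matrix (Fin p) (Fin p) ℂ)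
        - A.map (Complex.ofReal)
        - Complex.exp (-(Complex.I * (ω : ℂ) * (τ : ℂ))) • C.map (Complex.ofReal)).det
        = 0} := by
  refine Set.Finite.subset (s := ⋃ z ∈ {z | q.IsRoot z},
    ⋃ μ ∈ {μ | (A.map ofReal + z • C.map ofReal).charpoly.IsRoot μ},
      {τ : ℝ | ∃ ω : ℝ, ω ≠ 0 ∧ 0 < ω * τ ∧ ω * τ < 2 * Real.pi ∧
        I * (ω : ℂ) = μ ∧ exp (-(I * (ω : ℂ) * (τ : ℂ))) = z}) ?_ ?_
  · refine (Polynomial.finite_setOfPred_isRoot hq0).biUnion fun z _ =>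
      (Polynomial.finite_setOfPred_isRoot (charpoly_monic _).ne_zero).biUnion fun μ _ =>
        Set.Subsingleton.finite ?_
    rintro τ ⟨ω, hω, hτ, hτ', hμ, hz⟩ σ ⟨ω', -, hσ, hσ', hμ', hz'⟩
    obtain rfl : ω = ω' := by
      exact_mod_cast mul_left_cancel₀ I_ne_zero (hμ.trans hμ'.symm)
    exact delay_eq_of_exp_eq hω hτ hτ' hσ hσ' (hz.trans hz'.symm)
  · rintro τ ⟨-, ω, hω, hτ, hτ', hdet⟩
    simp only [Set.mem_iUnion, Set.mem_ofPred_eq]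
    refine ⟨_, ?_, _, ?_, ω, hω, hτ, hτ', rfl, rfl⟩
    · have hz : exp (-(I * (ω : ℂ) * (τ : ℂ))) *
          (starRingEnd ℂ) (exp (-(I * (ω : ℂ) * (τ : ℂ)))) = 1 := by
        rw [← exp_conj, ← exp_add]
        simp
      rw [Polynomial.IsRoot, ← det_auxiliary_eq_zero A C hz (by simp) hdet, hq,
        ← Polynomial.coe_evalRingHom, RingHom.map_det]
      congr 1
      ext i j
      simp [mul_add]
    · rw [Polynomial.IsRoot, eval_charpoly, ← hdet, sub_sub, smul_one_eq_diagonal]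
      rfl
end

section
/- Invariance of the root tendency (Proposition 2, quasipolynomial form): Let P₀, P₁, …, P_N be polynomials with complex coefficients, defining the characteristic quasipolynomial f(s, τ) = Σ_{k=0}^{N} Pₖ(s)·e^{−k s τ}. Fix ω ∈ ℝ with ω ≠ 0, and let τ₁, τ₂ ∈ ℝ satisfy e^{−iωτ₁} = e^{−iωτ₂} =: z (equivalently, τ₂ = τ₁ + 2πm/ω for some integer m). Set h = Σ_{k=0}^{N} k·Pₖ(iω)·zᵏ and g = Σ_{k=0}^{N} Pₖ′(iω)·zᵏ, and assume h ≠ 0, g − τ₁·h ≠ 0, and g − τ₂·h ≠ 0. Then sign( Re( iω·h / (g − τ₁·h) ) ) = sign( Re( iω·h / (g − τ₂·h) ) ). (The quantity iω·h/(g − τ·h) is the implicit derivative ∂s/∂τ of a root branch of f(s, τ) = 0 at the imaginary root s = iω, so the root tendency RT = sign Re(∂s/∂τ) is the same at a kernel point and all of its offspring.) -/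
open Complex Polynomial Finset

theorem re_I_mul_div_sub_ofReal_mul (ω τ : ℝ) (h g : ℂ) :
    (I * (ω : ℂ) * h / (g - (τ : ℂ) * h)).re
      = ω * (g.im * h.re - g.re * h.im) / normSq (g - (τ : ℂ) * h) := by
  rw [div_re, ← add_div]
  congr 1
  simp
  ring

theorem sign_div_of_pos (a : ℝ) {b : ℝ} (hb : 0 < b) : Real.sign (a / b) = Real.sign a := by
  rcases lt_trichotomy a 0 with ha | rfl | ha
  · rw [Real.sign_of_neg ha, Real.sign_of_neg (div_neg_of_neg_of_pos ha hb)]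
  · rw [zero_div]
  · rw [Real.sign_of_pos ha, Real.sign_of_pos (div_pos ha hb)]

/-- Invariance of the root tendency: for a quasipolynomial
`f(s,τ) = Σₖ Pₖ(s)e^{−ksτ}`, at an imaginary root `s = iω` with
`z = e^{−iωτ₁} = e^{−iωτ₂}`, set `h = Σₖ k·Pₖ(iω)zᵏ` and
`g = Σₖ Pₖ′(iω)zᵏ`. Then the root tendency
`sign Re(iω·h/(g − τ·h))` is the same at `τ₁` and at `τ₂`. -/
theorem root_tendency_invariance
    (N : ℕ) (P : ℕ → Polynomial ℂ) (ω : ℝ) (hω : ω ≠ 0)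
    (τ₁ τ₂ : ℝ) (z : ℂ)
    (hz₁ : Complex.exp (-(Complex.I * (ω : ℂ) * (τ₁ : ℂ))) = z)
    (hz₂ : Complex.exp (-(Complex.I * (ω : ℂ) * (τ₂ : ℂ))) = z)
    (h g : ℂ)
    (hh : h = ∑ k ∈ Finset.range (N + 1),
      (k : ℂ) * (P k).eval (Complex.I * (ω : ℂ)) * z ^ k)
    (hg : g = ∑ k ∈ Finset.range (N + 1),
      ((P k).derivative).eval (Complex.I * (ω : ℂ)) * z ^ k)
    (hh0 : h ≠ 0) (h1 : g - (τ₁ : ℂ) * h ≠ 0) (h2 : g - (τ₂ : ℂ) * h ≠ 0) :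
    Real.sign ((Complex.I * (ω : ℂ) * h / (g - (τ₁ : ℂ) * h)).re)
      = Real.sign ((Complex.I * (ω : ℂ) * h / (g - (τ₂ : ℂ) * h)).re) := by
  rw [re_I_mul_div_sub_ofReal_mul, re_I_mul_div_sub_ofReal_mul,
    sign_div_of_pos _ (normSq_pos.2 h1), sign_div_of_pos _ (normSq_pos.2 h2)]
end
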